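/- For u ∈ ℕ let f ∈ C^u(ℝ²) and set f_j := f·φ_j, where φ ∈ C₀^∞([−π,π]²) and φ_j(x) := φ(2^{j/2}x). Then for i ∈ {h,v}, even j ≥ 10, ℓ ∈ ℤ with |ℓ| ≤ 2^{j/2}, and any multi-index r ∈ ℕ₀², there is a constant C(u, r) > 0 such that ∫_{supp Ψ_{j,ℓ}^{(i)}} |∂^r[𝓕f_j](ξ)|² dξ ≤ C(u, r) · 2^{−j(2u + 1 + |r|₁)}. -/

import Mathlib

open Real MeasureTheory Set
open scoped Classical

noncomputable section

/-- A window function `g ∈ 𝒲`: nonnegative, even, with support `(-2/3, 2/3)`,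
and whose integer translates form a partition of unity. -/
structure IsWindow (g : ℝ → ℝ) : Prop where
  nonneg : ∀ x, 0 ≤ g x
  even_fun : ∀ x, g (-x) = g x
  supp_eq : Function.support g = Ioo (-(2/3) : ℝ) (2/3)
  partition : ∀ x : ℝ, HasSum (fun z : ℤ => g (x + (z : ℝ))) 1

/-- `g ∈ 𝒲^q`: a window function that is `q`-times continuously differentiable. -/
def IsWindowQ (g : ℝ → ℝ) (q : ℕ) : Prop := IsWindow g ∧ ContDiff ℝ q g

/-- `g̃(x) = g(x/2) - g(x)`. -/
def gtilde (g : ℝ → ℝ) : ℝ → ℝ := fun x => g (x / 2) - g x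

/-- Horizontal bivariate window `Ψ^{(h)}(x) = g̃(x₁) g(x₂)`. -/
def PsiH (g : ℝ → ℝ) : ℝ × ℝ → ℝ := fun x => gtilde g x.1 * g x.2

/-- Vertical bivariate window `Ψ^{(v)}(x) = g(x₁) g̃(x₂)`. -/
def PsiV (g : ℝ → ℝ) : ℝ × ℝ → ℝ := fun x => g x.1 * gtilde g x.2

/-- `Ψ_{j,ℓ}^{(i)}(ξ) = Ψ^{(i)}((N_{j,ℓ}^{(i)})^{-T} ξ)`, where the inverse transpose of the
shear matrices has been written out explicitly.  `i = true` is the horizontal case `(h)`,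
`i = false` the vertical case `(v)`. -/
def PsiJL (g : ℝ → ℝ) (i : Bool) (j : ℕ) (ℓ : ℤ) : ℝ × ℝ → ℝ := fun ξ =>
  if i then
    PsiH g ((2:ℝ) ^ (-(j:ℝ)) * ξ.1,
            (2:ℝ) ^ (-(j:ℝ)/2) * ξ.2 - (ℓ:ℝ) * (2:ℝ) ^ (-(j:ℝ)) * ξ.1)
  else
    PsiV g ((2:ℝ) ^ (-(j:ℝ)/2) * ξ.1 - (ℓ:ℝ) * (2:ℝ) ^ (-(j:ℝ)) * ξ.2,
            (2:ℝ) ^ (-(j:ℝ)) * ξ.2)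

/-- Discrete angles `θ_{j,ℓ}^{(h)} = arctan(ℓ 2^{-j/2})`,
`θ_{j,ℓ}^{(v)} = arccot(ℓ 2^{-j/2}) = π/2 - arctan(ℓ 2^{-j/2})`. -/
def thetaJL (i : Bool) (j : ℕ) (ℓ : ℤ) : ℝ :=
  if i then arctan ((ℓ:ℝ) * (2:ℝ) ^ (-(j:ℝ)/2))
  else π/2 - arctan ((ℓ:ℝ) * (2:ℝ) ^ (-(j:ℝ)/2))

/-- The pattern `𝒫(N_{j,ℓ}^{(i)}) = (N_{j,ℓ}^{(i)})^{-1} ℤ² ∩ [-1/2,1/2)²`: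
`y` belongs to the pattern iff `N_{j,ℓ}^{(i)} y ∈ ℤ²` and `y ∈ [-1/2,1/2)²`. -/
def pattern (i : Bool) (j : ℕ) (ℓ : ℤ) : Set (ℝ × ℝ) :=
  {y : ℝ × ℝ |
    (∃ k : ℤ × ℤ,
      (if i then ((2:ℝ)^(j:ℝ) * y.1 + (ℓ:ℝ) * (2:ℝ)^((j:ℝ)/2) * y.2, (2:ℝ)^((j:ℝ)/2) * y.2)
       else ((2:ℝ)^((j:ℝ)/2) * y.1, (ℓ:ℝ) * (2:ℝ)^((j:ℝ)/2) * y.1 + (2:ℝ)^(j:ℝ) * y.2))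
        = ((k.1 : ℝ), (k.2 : ℝ)))
    ∧ y.1 ∈ Ico (-(1/2) : ℝ) (1/2) ∧ y.2 ∈ Ico (-(1/2) : ℝ) (1/2)}

/-- `ỹ = y - (2^{-j-1},0)ᵀ` in the horizontal case, `ỹ = y - (0,2^{-j-1})ᵀ` in the vertical one. -/
def ytilde (i : Bool) (j : ℕ) (y : ℝ × ℝ) : ℝ × ℝ :=
  if i then (y.1 - (2:ℝ) ^ (-(j:ℝ) - 1), y.2) else (y.1, y.2 - (2:ℝ) ^ (-(j:ℝ) - 1))

/-- The trigonometric polynomial shearlet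
`ψ_{j,ℓ,y}^{(i)}(x) = ∑_{k∈ℤ²} Ψ_{j,ℓ}^{(i)}(k) e^{i k·(x - 2πỹ)}`. -/
def shearlet (g : ℝ → ℝ) (i : Bool) (j : ℕ) (ℓ : ℤ) (y : ℝ × ℝ) : ℝ × ℝ → ℂ := fun x =>
  ∑' k : ℤ × ℤ, (PsiJL g i j ℓ ((k.1 : ℝ), (k.2 : ℝ)) : ℂ) *
    Complex.exp (Complex.I *
      (((k.1 : ℝ) * (x.1 - 2*π*(ytilde i j y).1)
        + (k.2 : ℝ) * (x.2 - 2*π*(ytilde i j y).2) : ℝ) : ℂ))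

/-- `⟨f,h⟩₂ = (2π)^{-2} ∫_{𝕋²} f(x) conj(h(x)) dx`, with the torus realised as `[-π,π]²`. -/
def inner2 (f h : ℝ × ℝ → ℂ) : ℂ :=
  ((2*π)^2 : ℂ)⁻¹ * ∫ x in (Icc (-π) π ×ˢ Icc (-π) π : Set (ℝ × ℝ)), f x * (starRingEnd ℂ) (h x)

/-- The `2π`-periodization `f^{2π} = ∑_{n∈ℤ²} f(· + 2πn)`. -/
def periodize (f : ℝ × ℝ → ℝ) : ℝ × ℝ → ℝ := fun x =>
  ∑' n : ℤ × ℤ, f (x.1 + 2*π*(n.1 : ℝ), x.2 + 2*π*(n.2 : ℝ))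

/-- Euclidean norm `|x|₂` on `ℝ²`. -/
def nrm2 (x : ℝ × ℝ) : ℝ := Real.sqrt (x.1^2 + x.2^2)

/-- First partial derivative of a complex-valued function of two real variables. -/
def pd1 (f : ℝ × ℝ → ℂ) : ℝ × ℝ → ℂ := fun x => deriv (fun t => f (t, x.2)) x.1

/-- Second partial derivative of a complex-valued function of two real variables. -/
def pd2 (f : ℝ × ℝ → ℂ) : ℝ × ℝ → ℂ := fun x => deriv (fun t => f (x.1, t)) x.2

/-- `∂^r = ∂^{r₁+r₂}/∂x₁^{r₁}∂x₂^{r₂}` (complex-valued). -/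
def pd (r : ℕ × ℕ) (f : ℝ × ℝ → ℂ) : ℝ × ℝ → ℂ := pd1^[r.1] (pd2^[r.2] f)

/-- First partial derivative of a real-valued function of two real variables. -/
def pdR1 (f : ℝ × ℝ → ℝ) : ℝ × ℝ → ℝ := fun x => deriv (fun t => f (t, x.2)) x.1

/-- Second partial derivative of a real-valued function of two real variables. -/
def pdR2 (f : ℝ × ℝ → ℝ) : ℝ × ℝ → ℝ := fun x => deriv (fun t => f (x.1, t)) x.2

/-- `∂^r = ∂^{r₁+r₂}/∂x₁^{r₁}∂x₂^{r₂}` (real-valued). -/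
def pdR (r : ℕ × ℕ) (f : ℝ × ℝ → ℝ) : ℝ × ℝ → ℝ := pdR1^[r.1] (pdR2^[r.2] f)

/-- The Fourier transform `𝓕f(x) = (2π)^{-2} ∫_{ℝ²} f(ξ) e^{-iξ·x} dξ`. -/
def FT (f : ℝ × ℝ → ℂ) : ℝ × ℝ → ℂ := fun x =>
  ((2*π)^2 : ℂ)⁻¹ * ∫ ξ : ℝ × ℝ, f ξ * Complex.exp (-(Complex.I) * ((ξ.1*x.1 + ξ.2*x.2 : ℝ) : ℂ))

/-- Rotation matrix `R_γ` acting on `ℝ²`. -/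
def rotM (γ : ℝ) (x : ℝ × ℝ) : ℝ × ℝ :=
  (Real.cos γ * x.1 - Real.sin γ * x.2, Real.sin γ * x.1 + Real.cos γ * x.2)

/-- Transposed rotation matrix `R_γᵀ` acting on `ℝ²`. -/
def rotT (γ : ℝ) (x : ℝ × ℝ) : ℝ × ℝ :=
  (Real.cos γ * x.1 + Real.sin γ * x.2, -(Real.sin γ) * x.1 + Real.cos γ * x.2)

/-- The standard edge fragment `ℰ_j(x) = f(x) φ(2^{j/2}x) χ_{{x₁ ≥ E(x₂)}}(x)`. -/
def edgeFragment (f φ : ℝ × ℝ → ℝ) (E : ℝ → ℝ) (j : ℕ) : ℝ × ℝ → ℝ := fun x =>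
  f x * φ ((2:ℝ)^((j:ℝ)/2) * x.1, (2:ℝ)^((j:ℝ)/2) * x.2) * (if E x.2 ≤ x.1 then 1 else 0)

/-- The second-order differential operator `L = I + 2^j Δ`. -/
def Lop (j : ℕ) (f : ℝ × ℝ → ℂ) : ℝ × ℝ → ℂ := fun x =>
  f x + (Complex.ofReal ((2:ℝ)^(j:ℝ))) * (pd (2,0) f x + pd (0,2) f x)

/-- The dyadic square `Q` indexed by `(n₁,n₂)` at scale `j`. -/
def dyadicSquare (j : ℕ) (n : ℕ × ℕ) : Set (ℝ × ℝ) :=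
  Ico (2*π*(n.1:ℝ)*(2:ℝ)^(-(j:ℝ)/2) - π) (2*π*((n.1:ℝ)+1)*(2:ℝ)^(-(j:ℝ)/2) - π) ×ˢ
  Ico (2*π*(n.2:ℝ)*(2:ℝ)^(-(j:ℝ)/2) - π) (2*π*((n.2:ℝ)+1)*(2:ℝ)^(-(j:ℝ)/2) - π)

/-- The indices of the dyadic squares at scale `j` meeting `∂T` (the set `𝒬_j^1`). -/
def Q1set (T : Set (ℝ × ℝ)) (j : ℕ) : Finset (ℕ × ℕ) :=
  (Finset.range (2^(j/2)) ×ˢ Finset.range (2^(j/2))).filter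
    (fun n => (frontier T ∩ dyadicSquare j n).Nonempty)

/-- Fresnel integral `Fc(x) = ∫₀ˣ cos v/√v dv`. -/
def Fc (x : ℝ) : ℝ := ∫ v in (0:ℝ)..x, Real.cos v / Real.sqrt v

/-- Fresnel integral `Fs(x) = ∫₀ˣ sin v/√v dv`. -/
def Fs (x : ℝ) : ℝ := ∫ v in (0:ℝ)..x, Real.sin v / Real.sqrt v

/-- `F⁺ = Fc + Fs`. -/
def Fp (x : ℝ) : ℝ := Fc x + Fs x

/-- `F⁻ = Fc - Fs`. -/
def Fm (x : ℝ) : ℝ := Fc x - Fs x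

/-- `a(λ,p,A)` of the paper. -/
def aInt (g : ℝ → ℝ) (l p A : ℝ) : ℝ :=
  ∫ v in Ioi (0:ℝ),
    (g (2*Real.sqrt (A*l*v) + p*l) + g (2*Real.sqrt (A*l*v) - p*l)) * (Real.cos v / Real.sqrt v)

/-- `b(λ,p,A)` of the paper. -/
def bInt (g : ℝ → ℝ) (l p A : ℝ) : ℝ :=
  ∫ v in Ioi (0:ℝ),
    (g (2*Real.sqrt (A*l*v) + p*l) + g (2*Real.sqrt (A*l*v) - p*l)) * (Real.sin v / Real.sqrt v)

/-- `P₁(D,p,A)` of the paper. -/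
def P1 (g : ℝ → ℝ) (D p A : ℝ) : ℝ :=
  ∫ l in (1/3 : ℝ)..(4/3),
    gtilde g l * l⁻¹ *
      ((aInt g l p A + bInt g l p A) * Real.cos (D*l)
        + (aInt g l p A - bInt g l p A) * Real.sin (D*l))

/-- `P₂(D,p,A)` of the paper. -/
def P2 (g : ℝ → ℝ) (D p A : ℝ) : ℝ :=
  ∫ l in (1/3 : ℝ)..(4/3),
    gtilde g l * l⁻¹ *
      ((aInt g l p A + bInt g l p A) * Real.sin (D*l)
        - (aInt g l p A - bInt g l p A) * Real.cos (D*l))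


open scoped FourierTransform

/-- The Fourier transform of an integrable `L²` function agrees almost everywhere with its
`L²` Fourier transform. -/
theorem coeFn_fourier_toLp_ae_eq {V : Type*} [NormedAddCommGroup V] [InnerProductSpace ℝ V]
    [FiniteDimensional ℝ V] [MeasurableSpace V] [BorelSpace V] {f : V → ℂ}
    (hf : Integrable f) (hf2 : MemLp f 2) :
    (𝓕 (hf2.toLp f) : Lp (α := V) ℂ 2 volume) =ᵐ[volume] 𝓕 f := by
  have hcont : Continuous (𝓕 f) :=
    VectorFourier.fourierIntegral_continuous Real.continuous_fourierChar
      (by exact continuous_inner) hf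
  refine ae_eq_of_integral_contDiff_smul_eq
    ((Lp.memLp _).locallyIntegrable (by norm_num)) hcont.locallyIntegrable fun ψ hψ hψc => ?_
  have hψc' : HasCompactSupport (fun x => (ψ x : ℂ)) := hψc.comp_left Complex.ofReal_zero
  have hψ' : ContDiff ℝ ((⊤ : ℕ∞) : WithTop ℕ∞) (fun x => (ψ x : ℂ)) :=
    Complex.ofRealCLM.contDiff.comp hψ
  let Ψ : SchwartzMap V ℂ := hψc'.toSchwartzMap hψ'
  have hΨ : ∀ x, Ψ x = (ψ x : ℂ) := fun x => rfl
  have h1 := congrArg (fun T => T Ψ) (Lp.fourier_toTemperedDistribution_eq (hf2.toLp f))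
  simp only [TemperedDistribution.fourier_apply, Lp.toTemperedDistribution_apply] at h1
  have h2 := VectorFourier.integral_fourierIntegral_smul_eq_flip (f := (Ψ : V → ℂ)) (g := f)
    (μ := volume) (ν := volume) (L := innerₗ V) Real.continuous_fourierChar
    (by exact continuous_inner) Ψ.integrable hf
  rw [flip_innerₗ] at h2
  calc ∫ x, ψ x • (𝓕 (hf2.toLp f) : Lp (α := V) ℂ 2 volume) x
      = ∫ x, Ψ x • (𝓕 (hf2.toLp f) : Lp (α := V) ℂ 2 volume) x := by simp [hΨ]
    _ = ∫ x, (𝓕 Ψ) x • (hf2.toLp f) x := h1.symm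
    _ = ∫ x, (𝓕 Ψ) x • f x := by
        refine integral_congr_ae ?_
        filter_upwards [hf2.coeFn_toLp] with x hx
        rw [hx]
    _ = ∫ x, Ψ x • 𝓕 f x := by
        rw [SchwartzMap.fourier_coe]; exact h2
    _ = ∫ x, ψ x • 𝓕 f x := by simp [hΨ]

/-- **Plancherel's theorem** for functions in `L¹ ∩ L²`. -/
theorem integral_norm_sq_fourier {V : Type*} [NormedAddCommGroup V] [InnerProductSpace ℝ V]
    [FiniteDimensional ℝ V] [MeasurableSpace V] [BorelSpace V] {f : V → ℂ}
    (hf : Integrable f) (hf2 : MemLp f 2) :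
    Integrable (fun x => ‖𝓕 f x‖ ^ 2) ∧ ∫ x, ‖𝓕 f x‖ ^ 2 = ∫ x, ‖f x‖ ^ 2 := by
  have hae := coeFn_fourier_toLp_ae_eq hf hf2
  have hF : MemLp (𝓕 f) 2 := (memLp_congr_ae hae).1 (Lp.memLp _)
  refine ⟨(memLp_two_iff_integrable_sq_norm hF.1).1 hF, ?_⟩
  have hn : eLpNorm (𝓕 f) 2 volume = eLpNorm f 2 volume := by
    have := congrArg ENNReal.ofReal (Lp.norm_fourier_eq (hf2.toLp f))
    rwa [Lp.norm_def, Lp.norm_def, ENNReal.ofReal_toReal (Lp.eLpNorm_ne_top _),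
      ENNReal.ofReal_toReal (Lp.eLpNorm_ne_top _), eLpNorm_congr_ae hae,
      eLpNorm_congr_ae hf2.coeFn_toLp] at this
  have h1 := hF.eLpNorm_eq_integral_rpow_norm (by norm_num) (by norm_num)
  have h2 := hf2.eLpNorm_eq_integral_rpow_norm (by norm_num) (by norm_num)
  rw [h1, h2, ENNReal.ofReal_eq_ofReal_iff (by positivity) (by positivity)] at hn
  norm_num [← Real.sqrt_eq_rpow] at hn
  exact (Real.sqrt_inj (by positivity) (by positivity)).1 hn

theorem FT_eq_fourier (F : ℝ × ℝ → ℂ) (x : ℝ × ℝ) :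
    FT F x = ((2 * π) ^ 2 : ℂ)⁻¹ * 𝓕 (fun z : ℂ => F (Complex.measurableEquivRealProd z))
      (Complex.measurableEquivRealProd.symm ((2 * π)⁻¹ • x)) := by
  rw [FT, Real.fourier_eq', ← Complex.volume_preserving_equiv_real_prod.integral_comp'
    (fun ξ : ℝ × ℝ => F ξ * Complex.exp (-(Complex.I) * ((ξ.1 * x.1 + ξ.2 * x.2 : ℝ) : ℂ)))]
  congr 2 with z
  rw [smul_eq_mul, mul_comm]
  congr 2
  have hπ : (π : ℂ) ≠ 0 := by exact_mod_cast Real.pi_ne_zero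
  simp [Complex.measurableEquivRealProd_apply, Complex.measurableEquivRealProd_symm_apply,
    Complex.inner]
  field_simp

theorem integral_norm_sq_FT_le {F : ℝ × ℝ → ℂ} (hF : Continuous F) (hc : HasCompactSupport F) :
    Integrable (fun ξ => ‖FT F ξ‖ ^ 2) ∧ ∫ ξ, ‖FT F ξ‖ ^ 2 ≤ ∫ x, ‖F x‖ ^ 2 := by
  have hmp := Complex.volume_preserving_equiv_real_prod
  set e := Complex.measurableEquivRealProd with he
  have hemb := e.measurableEmbedding
  have hsymm : MeasurePreserving e.symm := hmp.symm
  have h1 : Integrable (fun z => F (e z)) :=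
    (hmp.integrable_comp_emb hemb).2 (hF.integrable_of_hasCompactSupport hc)
  have h2 : MemLp (fun z => F (e z)) 2 :=
    (hF.memLp_of_hasCompactSupport hc).comp_measurePreserving hmp
  obtain ⟨hi, hp⟩ := integral_norm_sq_fourier h1 h2
  set G : ℝ × ℝ → ℝ := fun p => ‖𝓕 (fun z : ℂ => F (e z)) (e.symm p)‖ ^ 2 with hG
  have hGi : Integrable G := (hsymm.integrable_comp_emb e.symm.measurableEmbedding).2 hi
  have hFT : ∀ ξ, ‖FT F ξ‖ ^ 2 = ((2 * π) ^ 4)⁻¹ * G ((2 * π)⁻¹ • ξ) := fun ξ => by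
    rw [FT_eq_fourier, norm_mul, mul_pow]
    simp only [hG, norm_inv, norm_pow, norm_mul, Complex.norm_ofNat, Complex.norm_real,
      Real.norm_eq_abs, abs_of_pos Real.pi_pos, inv_pow, ← pow_mul]
    rfl
  have hπ : (0 : ℝ) < 2 * π := by positivity
  simp only [hFT]
  refine ⟨(hGi.comp_smul (inv_ne_zero hπ.ne')).const_mul _, ?_⟩
  have hGF : ∫ p, G p = ∫ x, ‖F x‖ ^ 2 := by
    rw [← hmp.integral_comp' (g := fun x => ‖F x‖ ^ 2), ← hp]
    exact hsymm.integral_comp' (fun z => ‖𝓕 (fun z : ℂ => F (e z)) z‖ ^ 2)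
  rw [integral_const_mul, Measure.integral_comp_smul, hGF, smul_eq_mul, ← mul_assoc]
  refine mul_le_of_le_one_left (by positivity) ?_
  have : Module.finrank ℝ (ℝ × ℝ) = 2 := by simp
  rw [this, inv_pow, inv_inv, abs_of_nonneg (by positivity)]
  have hge : (1 : ℝ) ≤ (2 * π) ^ 2 := one_le_pow₀ (by linarith [Real.pi_gt_three])
  rw [show (2 * π) ^ 4 = (2 * π) ^ 2 * (2 * π) ^ 2 by ring, mul_inv, mul_assoc,
    inv_mul_cancel₀ (by positivity), mul_one]
  exact inv_le_one_of_one_le₀ hge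

theorem FT_add {F G : ℝ × ℝ → ℂ} (hF : Continuous F) (hFc : HasCompactSupport F)
    (hG : Continuous G) (hGc : HasCompactSupport G) (ξ : ℝ × ℝ) :
    FT (fun x => F x + G x) ξ = FT F ξ + FT G ξ := by
  simp only [FT, ← mul_add, add_mul]
  rw [integral_add]
  · exact Continuous.integrable_of_hasCompactSupport (by fun_prop) hFc.mul_right
  · exact Continuous.integrable_of_hasCompactSupport (by fun_prop) hGc.mul_right

theorem FT_const_mul (c : ℂ) (F : ℝ × ℝ → ℂ) (ξ : ℝ × ℝ) :
    FT (fun x => c * F x) ξ = c * FT F ξ := by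
  simp only [FT, mul_assoc, integral_const_mul]
  ring

theorem hasDerivAt_integral_mul_cexp {F : ℝ × ℝ → ℂ} (hF : Continuous F)
    (hFc : HasCompactSupport F) {a b : ℝ × ℝ → ℝ} (ha : Continuous a) (hb : Continuous b) (t : ℝ) :
    HasDerivAt (fun t : ℝ => ∫ x, F x * Complex.exp (-Complex.I * ((a x * t + b x : ℝ) : ℂ)))
      (∫ x, -Complex.I * a x * F x * Complex.exp (-Complex.I * ((a x * t + b x : ℝ) : ℂ))) t := by
  refine (hasDerivAt_integral_of_dominated_loc_of_deriv_le (bound := fun x => ‖(a x : ℂ) * F x‖)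
    (F' := fun (t : ℝ) (x : ℝ × ℝ) =>
      -Complex.I * a x * F x * Complex.exp (-Complex.I * ((a x * t + b x : ℝ) : ℂ)))
    Filter.univ_mem (.of_forall fun s => ?_) ?_ ?_ (.of_forall fun x s _ => ?_) ?_
    (.of_forall fun x s _ => ?_)).2
  · exact Continuous.aestronglyMeasurable (by fun_prop)
  · exact Continuous.integrable_of_hasCompactSupport (by fun_prop) hFc.mul_right
  · exact Continuous.aestronglyMeasurable (by fun_prop)
  · rw [mul_assoc (-Complex.I), norm_mul, norm_mul, norm_neg, Complex.norm_I, one_mul,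
      mul_comm (-Complex.I), ← neg_mul_comm, ← Complex.ofReal_neg, Complex.norm_exp_ofReal_mul_I,
      mul_one]
  · exact (Continuous.integrable_of_hasCompactSupport (by fun_prop) hFc.mul_left).norm
  · have h : HasDerivAt (fun t : ℝ => ((a x * t + b x : ℝ) : ℂ)) (a x : ℂ) s := by
      simpa using (((hasDerivAt_id s).const_mul (a x)).add_const (b x)).ofReal_comp
    convert! ((h.const_mul (-Complex.I)).cexp).const_mul (F x) using 1
    ring

theorem pd1_FT {F : ℝ × ℝ → ℂ} (hF : Continuous F) (hFc : HasCompactSupport F) :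
    pd1 (FT F) = FT (fun x => -Complex.I * x.1 * F x) := by
  ext ξ
  exact ((hasDerivAt_integral_mul_cexp hF hFc continuous_fst
    (continuous_snd.mul continuous_const) ξ.1).const_mul _).deriv

theorem pd2_FT {F : ℝ × ℝ → ℂ} (hF : Continuous F) (hFc : HasCompactSupport F) :
    pd2 (FT F) = FT (fun x => -Complex.I * x.2 * F x) := by
  ext ξ
  have h := ((hasDerivAt_integral_mul_cexp hF hFc continuous_snd
    (b := fun x => x.1 * ξ.1) (by fun_prop) ξ.2).const_mul ((2 * π) ^ 2 : ℂ)⁻¹).deriv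
  simp only [add_comm (Prod.snd _ * _) (Prod.fst _ * _)] at h
  exact h

theorem pd_FT (r : ℕ × ℕ) {F : ℝ × ℝ → ℂ} (hF : Continuous F) (hFc : HasCompactSupport F) :
    pd r (FT F) =
      FT (fun x => (-Complex.I * x.1) ^ r.1 * ((-Complex.I * x.2) ^ r.2 * F x)) := by
  have h2 : ∀ n, pd2^[n] (FT F) = FT (fun x => (-Complex.I * x.2) ^ n * F x) := by
    intro n
    induction n with
    | zero => simp
    | succ n ih =>
      rw [Function.iterate_succ_apply', ih, pd2_FT (F := fun x => (-Complex.I * x.2) ^ n * F x) (by fun_prop) hFc.mul_left]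
      congr with x
      ring
  have h1 : ∀ n, pd1^[n] (pd2^[r.2] (FT F)) =
      FT (fun x => (-Complex.I * x.1) ^ n * ((-Complex.I * x.2) ^ r.2 * F x)) := by
    intro n
    induction n with
    | zero => simp [h2]
    | succ n ih =>
      rw [Function.iterate_succ_apply', ih,
        pd1_FT (F := fun x => (-Complex.I * x.1) ^ n * ((-Complex.I * x.2) ^ r.2 * F x))
          (by fun_prop) hFc.mul_left.mul_left]
      congr with x
      ring
  exact h1 r.1

theorem FT_fderiv {F : ℝ × ℝ → ℂ} (hF : ContDiff ℝ 1 F) (hFc : HasCompactSupport F)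
    (v ξ : ℝ × ℝ) :
    FT (fun x => fderiv ℝ F x v) ξ =
      Complex.I * ((v.1 * ξ.1 + v.2 * ξ.2 : ℝ) : ℂ) * FT F ξ := by
  set E : ℝ × ℝ → ℂ := fun x => Complex.exp (-Complex.I * ((x.1 * ξ.1 + x.2 * ξ.2 : ℝ) : ℂ))
    with hE
  have hd : ∀ x, HasFDerivAt E (E x • (-Complex.I) • Complex.ofRealCLM.comp
      ((ξ.1 • ContinuousLinearMap.fst ℝ ℝ ℝ) + ξ.2 • ContinuousLinearMap.snd ℝ ℝ ℝ)) x := by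
    intro x
    have h0 : HasFDerivAt (fun x : ℝ × ℝ => ((x.1 * ξ.1 + x.2 * ξ.2 : ℝ) : ℂ))
        (Complex.ofRealCLM.comp
          ((ξ.1 • ContinuousLinearMap.fst ℝ ℝ ℝ) + ξ.2 • ContinuousLinearMap.snd ℝ ℝ ℝ)) x :=
      Complex.ofRealCLM.hasFDerivAt.comp x
        ((hasFDerivAt_fst.mul_const ξ.1).add (hasFDerivAt_snd.mul_const ξ.2))
    exact (h0.const_mul (-Complex.I)).cexp
  have hEv : ∀ x, fderiv ℝ E x v = -Complex.I * ((v.1 * ξ.1 + v.2 * ξ.2 : ℝ) : ℂ) * E x := by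
    intro x
    rw [(hd x).fderiv]
    simp
    ring
  have hEc : Continuous E := by fun_prop
  have hFv : Continuous (fun x => fderiv ℝ F x v) :=
    (hF.continuous_fderiv one_ne_zero).clm_apply continuous_const
  have hFvc : HasCompactSupport (fun x => fderiv ℝ F x v) := hFc.fderiv_apply ℝ v
  have key := integral_mul_fderiv_eq_neg_fderiv_mul_of_integrable (μ := volume) (f := E) (g := F)
    (v := v)
    (by
      simp only [hEv]
      exact Continuous.integrable_of_hasCompactSupport (by fun_prop) hFc.mul_left)
    ((hEc.mul hFv).integrable_of_hasCompactSupport hFvc.mul_left)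
    ((hEc.mul hF.continuous).integrable_of_hasCompactSupport hFc.mul_left)
    (fun x _ => (hd x).differentiableAt) (fun x _ => hF.differentiable one_ne_zero x)
  simp only [hEv, mul_assoc, integral_const_mul] at key
  simp only [FT]
  simp only [mul_comm _ (Complex.exp _)]
  simp only [hE] at key
  rw [key]
  ring

theorem hasCompactSupport_comp_smul {Φ : ℝ × ℝ → ℂ} (hΦ : HasCompactSupport Φ) {s : ℝ}
    (hs : s ≠ 0) : HasCompactSupport (fun x => Φ (s • x)) :=
  hΦ.comp_homeomorph (Homeomorph.smulOfNeZero s hs)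

theorem hasCompactSupport_mul_comp_smul (h : ℝ × ℝ → ℂ) {Φ : ℝ × ℝ → ℂ}
    (hΦ : HasCompactSupport Φ) {s : ℝ} (hs : s ≠ 0) :
    HasCompactSupport (fun x => h x * Φ (s • x)) :=
  (hasCompactSupport_comp_smul hΦ hs).mul_left

theorem integral_norm_sq_FT_mul_comp_smul_le {h Φ : ℝ × ℝ → ℂ} (hh : Continuous h)
    (hΦ : Continuous Φ) (hΦc : HasCompactSupport Φ) :
    ∃ C ≥ 0, ∀ s : ℝ, 1 ≤ s → s ^ 2 * ∫ ξ, ‖FT (fun x => h x * Φ (s • x)) ξ‖ ^ 2 ≤ C := by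
  obtain ⟨R, hR⟩ := hΦc.isCompact.isBounded.subset_closedBall 0
  obtain ⟨M, hM⟩ := (isCompact_closedBall (0 : ℝ × ℝ) R).exists_bound_of_continuousOn
    hh.continuousOn
  refine ⟨M ^ 2 * ∫ x, ‖Φ x‖ ^ 2, by positivity, fun s hs => ?_⟩
  have hs0 : 0 < s := by linarith
  have hΦs : HasCompactSupport (fun x => Φ (s • x)) := hasCompactSupport_comp_smul hΦc hs0.ne'
  have hpt : ∀ x, ‖h x * Φ (s • x)‖ ^ 2 ≤ M ^ 2 * ‖Φ (s • x)‖ ^ 2 := fun x => by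
    by_cases hx : Φ (s • x) = 0
    · simp [hx]
    · have hsx : s • x ∈ Metric.closedBall (0 : ℝ × ℝ) R := hR (subset_tsupport _ hx)
      have hx' : x ∈ Metric.closedBall (0 : ℝ × ℝ) R := by
        rw [mem_closedBall_zero_iff] at hsx ⊢
        rw [norm_smul, Real.norm_eq_abs, abs_of_pos hs0] at hsx
        exact (le_mul_of_one_le_left (norm_nonneg x) hs).trans hsx
      rw [norm_mul, mul_pow]
      gcongr
      exact hM x hx'
  have hint : Integrable (fun x => ‖Φ (s • x)‖ ^ 2) :=
    (memLp_two_iff_integrable_sq_norm (by fun_prop)).1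
      ((by fun_prop : Continuous fun x => Φ (s • x)).memLp_of_hasCompactSupport hΦs)
  calc s ^ 2 * ∫ ξ, ‖FT (fun x => h x * Φ (s • x)) ξ‖ ^ 2
      ≤ s ^ 2 * ∫ x, ‖h x * Φ (s • x)‖ ^ 2 := by
        exact mul_le_mul_of_nonneg_left (integral_norm_sq_FT_le (by fun_prop)
          (hasCompactSupport_mul_comp_smul h hΦc hs0.ne')).2 (by positivity)
    _ ≤ s ^ 2 * ∫ x, M ^ 2 * ‖Φ (s • x)‖ ^ 2 := by
        refine mul_le_mul_of_nonneg_left ?_ (by positivity)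
        exact integral_mono_of_nonneg (.of_forall fun x => by positivity) (hint.const_mul _)
          (.of_forall hpt)
    _ = M ^ 2 * ∫ x, ‖Φ x‖ ^ 2 := by
        have : Module.finrank ℝ (ℝ × ℝ) = 2 := by simp
        rw [integral_const_mul, Measure.integral_comp_smul volume (fun x => ‖Φ x‖ ^ 2), this,
          abs_of_nonneg (by positivity), smul_eq_mul]
        field_simp

/-- Integration by parts against a dilated cutoff. -/
theorem FT_mul_comp_smul_eq {h Φ : ℝ × ℝ → ℂ} (hh : ContDiff ℝ 1 h) (hΦ : ContDiff ℝ 1 Φ)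
    (hΦc : HasCompactSupport Φ) {s : ℝ} (hs : s ≠ 0) (v ξ : ℝ × ℝ) :
    Complex.I * ((v.1 * ξ.1 + v.2 * ξ.2 : ℝ) : ℂ) * FT (fun x => h x * Φ (s • x)) ξ =
      FT (fun x => fderiv ℝ h x v * Φ (s • x)) ξ +
        s * FT (fun x => h x * fderiv ℝ Φ (s • x) v) ξ := by
  have hc1 := hasCompactSupport_mul_comp_smul h hΦc hs
  have hc2 := hasCompactSupport_mul_comp_smul (fun x => fderiv ℝ h x v) hΦc hs
  have hc3 : HasCompactSupport (fun x => (s : ℂ) * (h x * fderiv ℝ Φ (s • x) v)) :=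
    (hasCompactSupport_mul_comp_smul h (hΦc.fderiv_apply ℝ v) hs).mul_left
  have hdh : Continuous (fun x => fderiv ℝ h x v) :=
    (hh.continuous_fderiv one_ne_zero).clm_apply continuous_const
  have hdΦ : Continuous (fun x => fderiv ℝ Φ x v) :=
    (hΦ.continuous_fderiv one_ne_zero).clm_apply continuous_const
  have hdΦs : Continuous (fun x => fderiv ℝ Φ (s • x) v) := hdΦ.comp (continuous_const_smul s)
  have hΦ0 := hΦ.continuous
  have hh0 := hh.continuous
  rw [← FT_fderiv (by fun_prop) hc1, ← FT_const_mul, ← FT_add (by fun_prop) hc2 (by fun_prop) hc3]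
  congr with x
  have h1 : HasFDerivAt (fun x => Φ (s • x))
      ((fderiv ℝ Φ (s • x)).comp (s • ContinuousLinearMap.id ℝ (ℝ × ℝ))) x :=
    ((hΦ.differentiable one_ne_zero) (s • x)).hasFDerivAt.comp x ((hasFDerivAt_id x).const_smul s)
  have h2 := ((hh.differentiable one_ne_zero) x).hasFDerivAt.mul h1
  change fderiv ℝ (h * fun x => Φ (s • x)) x v = _
  rw [h2.fderiv]
  simp
  ring

/-- `L²` decay, away from low frequencies in the direction `v`, of the Fourier transform of a
`C^m` function localized at scale `s⁻¹` by a smooth cutoff. -/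
theorem exists_setIntegral_norm_sq_FT_mul_comp_smul_le (v : ℝ × ℝ) (N : ℕ) :
    ∀ m : ℕ, ∀ h Φ : ℝ × ℝ → ℂ, ContDiff ℝ m h → ContDiff ℝ (⊤ : ℕ∞) Φ → HasCompactSupport Φ →
      ∃ C ≥ 0, ∀ s : ℝ, 1 ≤ s → s ^ (2 + 2 * min (2 * m) N) *
        ∫ ξ in {ξ : ℝ × ℝ | s ^ 2 / 3 ≤ |v.1 * ξ.1 + v.2 * ξ.2|},
          ‖FT (fun x => h x * Φ (s • x)) ξ‖ ^ 2 ≤ C := by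
  have base : ∀ h Φ : ℝ × ℝ → ℂ, Continuous h → ContDiff ℝ (⊤ : ℕ∞) Φ → HasCompactSupport Φ →
      ∃ C ≥ 0, ∀ s : ℝ, 1 ≤ s → s ^ 2 *
        ∫ ξ in {ξ : ℝ × ℝ | s ^ 2 / 3 ≤ |v.1 * ξ.1 + v.2 * ξ.2|},
          ‖FT (fun x => h x * Φ (s • x)) ξ‖ ^ 2 ≤ C := by
    intro h Φ hh hΦ hΦc
    obtain ⟨C, hC0, hC⟩ := integral_norm_sq_FT_mul_comp_smul_le hh hΦ.continuous hΦc
    have hΦ0 := hΦ.continuous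
    refine ⟨C, hC0, fun s hs => le_trans ?_ (hC s hs)⟩
    have hs0 : s ≠ 0 := by linarith
    have hint := (integral_norm_sq_FT_le (F := fun x => h x * Φ (s • x)) (by fun_prop)
      (hasCompactSupport_mul_comp_smul h hΦc hs0)).1
    exact mul_le_mul_of_nonneg_left
      (setIntegral_le_integral hint (.of_forall fun _ => by positivity)) (by positivity)
  induction N with
  | zero =>
    intro m h Φ hh hΦ hΦc
    simpa using base h Φ hh.continuous hΦ hΦc
  | succ N ih =>
    rintro (_ | m) h Φ hh hΦ hΦc
    · simpa using base h Φ hh.continuous hΦ hΦc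
    have hh1 : ContDiff ℝ 1 h := hh.of_le (by norm_cast; omega)
    have hΦ1 : ContDiff ℝ 1 Φ := hΦ.of_le (by exact_mod_cast le_top)
    have hdh : ContDiff ℝ m (fun x => fderiv ℝ h x v) :=
      (hh.fderiv_right (by norm_cast)).clm_apply contDiff_const
    have hdΦ : ContDiff ℝ (⊤ : ℕ∞) (fun x => fderiv ℝ Φ x v) :=
      (hΦ.fderiv_right (by norm_cast)).clm_apply contDiff_const
    have hdΦc : HasCompactSupport (fun x => fderiv ℝ Φ x v) := hΦc.fderiv_apply ℝ v
    obtain ⟨A, hA0, hA⟩ := ih m _ Φ hdh hΦ hΦc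
    obtain ⟨B, hB0, hB⟩ := ih (m + 1) h _ hh hdΦ hdΦc
    refine ⟨18 * A + 18 * B, by positivity, fun s hs => ?_⟩
    have hs0 : 0 < s := by linarith
    replace hA := hA s hs
    replace hB := hB s hs
    set E := {ξ : ℝ × ℝ | s ^ 2 / 3 ≤ |v.1 * ξ.1 + v.2 * ξ.2|} with hE
    have hEm : MeasurableSet E := measurableSet_le (by fun_prop) (by fun_prop)
    have hint : ∀ {h Φ : ℝ × ℝ → ℂ}, Continuous h → Continuous Φ → HasCompactSupport Φ →
        IntegrableOn (fun ξ => ‖FT (fun x => h x * Φ (s • x)) ξ‖ ^ 2) E := fun hh hΦ hΦc =>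
      (integral_norm_sq_FT_le (by fun_prop)
        (hasCompactSupport_mul_comp_smul _ hΦc hs0.ne')).1.integrableOn
    have hiA := hint hdh.continuous hΦ.continuous hΦc
    have hiB := hint hh.continuous hdΦ.continuous hdΦc
    have hpt : ∀ ξ ∈ E, ‖FT (fun x => h x * Φ (s • x)) ξ‖ ^ 2 ≤
        18 / s ^ 4 * ‖FT (fun x => fderiv ℝ h x v * Φ (s • x)) ξ‖ ^ 2 +
        18 / s ^ 2 * ‖FT (fun x => h x * fderiv ℝ Φ (s • x) v) ξ‖ ^ 2 := by
      intro ξ hξ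
      have hkey := congrArg norm (FT_mul_comp_smul_eq hh1 hΦ1 hΦc hs0.ne' v ξ)
      rw [norm_mul, norm_mul, Complex.norm_I, one_mul, Complex.norm_real, Real.norm_eq_abs] at hkey
      have htri := norm_add_le (FT (fun x => fderiv ℝ h x v * Φ (s • x)) ξ)
        (s * FT (fun x => h x * fderiv ℝ Φ (s • x) v) ξ)
      rw [← hkey, norm_mul, Complex.norm_real, Real.norm_eq_abs, abs_of_pos hs0] at htri
      set a := ‖FT (fun x => fderiv ℝ h x v * Φ (s • x)) ξ‖
      set b := ‖FT (fun x => h x * fderiv ℝ Φ (s • x) v) ξ‖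
      set c := ‖FT (fun x => h x * Φ (s • x)) ξ‖
      have hc : s ^ 2 / 3 * c ≤ a + s * b :=
        (mul_le_mul_of_nonneg_right hξ (norm_nonneg _)).trans htri
      have hsq : (s ^ 2 / 3 * c) ^ 2 ≤ (a + s * b) ^ 2 :=
        pow_le_pow_left₀ (by positivity) hc 2
      have h2 : (s ^ 2 / 3 * c) ^ 2 ≤ 2 * a ^ 2 + 2 * (s * b) ^ 2 := by
        linarith [sq_nonneg (a - s * b)]
      calc c ^ 2 = 9 / s ^ 4 * (s ^ 2 / 3 * c) ^ 2 := by field_simp; norm_num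
        _ ≤ 9 / s ^ 4 * (2 * a ^ 2 + 2 * (s * b) ^ 2) := by gcongr
        _ = 18 / s ^ 4 * a ^ 2 + 18 / s ^ 2 * b ^ 2 := by field_simp; ring
    have hJ := setIntegral_mono_on (hint hh.continuous hΦ.continuous hΦc)
      ((hiA.const_mul (18 / s ^ 4)).add (hiB.const_mul (18 / s ^ 2))) hEm hpt
    rw [integral_add' (hiA.const_mul _) (hiB.const_mul _), integral_const_mul,
      integral_const_mul] at hJ
    have hKA : s ^ (2 + 2 * min (2 * (m + 1)) (N + 1)) ≤
        s ^ 4 * s ^ (2 + 2 * min (2 * m) N) := by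
      rw [← pow_add]
      exact pow_le_pow_right₀ hs (by omega)
    have hKB : s ^ (2 + 2 * min (2 * (m + 1)) (N + 1)) ≤
        s ^ 2 * s ^ (2 + 2 * min (2 * (m + 1)) N) := by
      rw [← pow_add]
      exact pow_le_pow_right₀ hs (by omega)
    set K := s ^ (2 + 2 * min (2 * (m + 1)) (N + 1))
    set IA := ∫ ξ in E, ‖FT (fun x => fderiv ℝ h x v * Φ (s • x)) ξ‖ ^ 2
    set IB := ∫ ξ in E, ‖FT (fun x => h x * fderiv ℝ Φ (s • x) v) ξ‖ ^ 2
    have hIA : 0 ≤ IA := integral_nonneg fun _ => by positivity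
    have hIB : 0 ≤ IB := integral_nonneg fun _ => by positivity
    calc K * ∫ ξ in E, ‖FT (fun x => h x * Φ (s • x)) ξ‖ ^ 2
        ≤ K * (18 / s ^ 4 * IA + 18 / s ^ 2 * IB) := by gcongr
      _ = K * (18 / s ^ 4 * IA) + K * (18 / s ^ 2 * IB) := mul_add _ _ _
      _ ≤ s ^ 4 * s ^ (2 + 2 * min (2 * m) N) * (18 / s ^ 4 * IA) +
          s ^ 2 * s ^ (2 + 2 * min (2 * (m + 1)) N) * (18 / s ^ 2 * IB) := by gcongr
      _ = 18 * (s ^ (2 + 2 * min (2 * m) N) * IA) +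
          18 * (s ^ (2 + 2 * min (2 * (m + 1)) N) * IB) := by field_simp
      _ ≤ 18 * A + 18 * B := by gcongr

theorem IsWindow.eq_one {g : ℝ → ℝ} (hg : IsWindow g) {x : ℝ} (hx : |x| ≤ 1 / 3) : g x = 1 := by
  have hs : HasSum (fun z : ℤ => g (x + z)) (g (x + (0 : ℤ))) := by
    refine hasSum_single 0 fun z hz => ?_
    by_contra hne
    have hmem : x + z ∈ Ioo (-(2 / 3) : ℝ) (2 / 3) := hg.supp_eq ▸ Function.mem_support.2 hne
    obtain ⟨h1, h2⟩ := abs_le.1 hx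
    have hz1 : (z : ℝ) < 1 := by linarith [hmem.2]
    have hz2 : (-1 : ℝ) < z := by linarith [hmem.1]
    exact hz (le_antisymm (Int.lt_add_one_iff.1 (by exact_mod_cast hz1))
      (Int.add_one_le_iff.2 (by exact_mod_cast hz2)))
  simpa using hs.unique (hg.partition x)

theorem IsWindow.le_abs_of_gtilde_ne_zero {g : ℝ → ℝ} (hg : IsWindow g) {x : ℝ}
    (hx : gtilde g x ≠ 0) : 1 / 3 ≤ |x| := by
  by_contra! hlt
  refine hx ?_
  rw [gtilde, hg.eq_one hlt.le, hg.eq_one, sub_self]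
  rw [abs_div, abs_two]
  linarith [abs_nonneg x]

theorem IsWindow.support_PsiJL_subset {g : ℝ → ℝ} (hg : IsWindow g) (i : Bool) (j : ℕ) (ℓ : ℤ) :
    Function.support (PsiJL g i j ℓ) ⊆
      {ξ : ℝ × ℝ | (2 : ℝ) ^ (j : ℝ) / 3 ≤
        |(if i then ((1, 0) : ℝ × ℝ) else (0, 1)).1 * ξ.1 +
          (if i then ((1, 0) : ℝ × ℝ) else (0, 1)).2 * ξ.2|} := by
  have key : ∀ t : ℝ, gtilde g ((2 : ℝ) ^ (-(j : ℝ)) * t) ≠ 0 → (2 : ℝ) ^ (j : ℝ) / 3 ≤ |t| := by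
    intro t ht
    have h := hg.le_abs_of_gtilde_ne_zero ht
    have hp : (0 : ℝ) < (2 : ℝ) ^ (j : ℝ) := by positivity
    rw [abs_mul, Real.rpow_neg zero_le_two, abs_of_pos (inv_pos.2 hp), ← div_eq_inv_mul,
      le_div_iff₀ hp] at h
    linarith
  intro ξ hξ
  cases i
  · simpa using key ξ.2 (right_ne_zero_of_mul (by simpa [PsiJL, PsiV] using hξ))
  · simpa using key ξ.1 (left_ne_zero_of_mul (by simpa [PsiJL, PsiH] using hξ))

/-- For `f ∈ C^u(ℝ²)` and `f_j = f·φ_j` with `φ ∈ C₀^∞([-π,π]²)`,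
`∫_{supp Ψ_{j,ℓ}^{(i)}} |∂^r[𝓕f_j](ξ)|² dξ ≤ C(u,r) 2^{-j(2u+1+|r|₁)}`. -/
theorem int_FT_fj_bound (u : ℕ) (hu : 1 ≤ u) (f : ℝ × ℝ → ℝ) (hf : ContDiff ℝ u f)
    (φ : ℝ × ℝ → ℝ) (hφ : ContDiff ℝ (⊤ : ℕ∞) φ)
    (hφs : tsupport φ ⊆ Icc (-π) π ×ˢ Icc (-π) π)
    (g : ℝ → ℝ) (hg : IsWindow g) (i : Bool) (r : ℕ × ℕ) :
    ∃ C > 0, ∀ j : ℕ, Even j → 10 ≤ j → ∀ ℓ : ℤ, |(ℓ : ℝ)| ≤ (2:ℝ)^((j:ℝ)/2) →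
      (∫ ξ in Function.support (PsiJL g i j ℓ),
          ‖pd r (FT (fun x =>
            ((f x * φ ((2:ℝ)^((j:ℝ)/2)*x.1, (2:ℝ)^((j:ℝ)/2)*x.2) : ℝ) : ℂ))) ξ‖^2)
        ≤ C * (2:ℝ)^(-(j:ℝ)*(2*(u:ℝ)+1+(r.1:ℝ)+(r.2:ℝ))) := by
  have hφc : HasCompactSupport φ :=
    (isCompact_Icc.prod isCompact_Icc).of_isClosed_subset (isClosed_tsupport φ) hφs
  have hφC : ContDiff ℝ (⊤ : ℕ∞) (fun x => (φ x : ℂ)) := Complex.ofRealCLM.contDiff.comp hφ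
  have hfC : ContDiff ℝ u (fun x => (f x : ℂ)) := Complex.ofRealCLM.contDiff.comp hf
  have hφCc : HasCompactSupport (fun x => (φ x : ℂ)) := hφc.comp_left Complex.ofReal_zero
  set Φ : ℝ × ℝ → ℂ := fun x =>
    (-Complex.I * x.1) ^ r.1 * ((-Complex.I * x.2) ^ r.2 * (φ x : ℂ)) with hΦdef
  have h1 : ContDiff ℝ (⊤ : ℕ∞) (fun x : ℝ × ℝ => (x.1 : ℂ)) :=
    Complex.ofRealCLM.contDiff.comp contDiff_fst
  have h2 : ContDiff ℝ (⊤ : ℕ∞) (fun x : ℝ × ℝ => (x.2 : ℂ)) :=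
    Complex.ofRealCLM.contDiff.comp contDiff_snd
  have hΦ : ContDiff ℝ (⊤ : ℕ∞) Φ :=
    ((contDiff_const.mul h1).pow _).mul (((contDiff_const.mul h2).pow _).mul hφC)
  have hΦc : HasCompactSupport Φ := hφCc.mul_left.mul_left
  obtain ⟨C, hC0, hC⟩ := exists_setIntegral_norm_sq_FT_mul_comp_smul_le
    (if i then ((1, 0) : ℝ × ℝ) else (0, 1)) (2 * u) u _ Φ hfC hΦ hΦc
  refine ⟨C + 1, by positivity, fun j _ _ ℓ _ => ?_⟩
  set s : ℝ := (2 : ℝ) ^ ((j : ℝ) / 2) with hs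
  have hs1 : 1 ≤ s := Real.one_le_rpow one_le_two (by positivity)
  have hs0 : 0 < s := by linarith
  have hspow : ∀ n : ℕ, s ^ n = (2 : ℝ) ^ ((j : ℝ) * n / 2) := fun n => by
    rw [hs, ← Real.rpow_mul_natCast zero_le_two]
    ring_nf
  have hs2 : s ^ 2 = (2 : ℝ) ^ (j : ℝ) := by
    rw [hspow]
    norm_num
  set E := {ξ : ℝ × ℝ | s ^ 2 / 3 ≤ |(if i then ((1, 0) : ℝ × ℝ) else (0, 1)).1 * ξ.1 +
    (if i then ((1, 0) : ℝ × ℝ) else (0, 1)).2 * ξ.2|} with hE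
  have hsub : Function.support (PsiJL g i j ℓ) ⊆ E := by
    rw [hE, hs2]
    exact hg.support_PsiJL_subset i j ℓ
  have hpd : ∀ ξ, ‖pd r (FT (fun x => ((f x * φ (s * x.1, s * x.2) : ℝ) : ℂ))) ξ‖ ^ 2 =
      (s ^ (2 * (r.1 + r.2)))⁻¹ * ‖FT (fun x => (f x : ℂ) * Φ (s • x)) ξ‖ ^ 2 := by
    intro ξ
    have hcont : Continuous (fun x : ℝ × ℝ => ((f x * φ (s * x.1, s * x.2) : ℝ) : ℂ)) := by
      have := hf.continuous
      have := hφ.continuous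
      fun_prop
    have hsupp : HasCompactSupport (fun x : ℝ × ℝ => ((f x * φ (s * x.1, s * x.2) : ℝ) : ℂ)) := by
      simp only [Complex.ofReal_mul]
      exact hasCompactSupport_mul_comp_smul _ hφCc hs0.ne'
    have hfun : (fun x : ℝ × ℝ => (-Complex.I * x.1) ^ r.1 *
        ((-Complex.I * x.2) ^ r.2 * ((f x * φ (s * x.1, s * x.2) : ℝ) : ℂ))) =
        fun x => ((s : ℂ) ^ (r.1 + r.2))⁻¹ * ((f x : ℂ) * Φ (s • x)) := by
      ext x
      have hsc : (s : ℂ) ≠ 0 := by exact_mod_cast hs0.ne'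
      simp only [hΦdef, smul_eq_mul, Complex.ofReal_mul,
        Prod.smul_def, mul_pow, pow_add]
      field_simp
    rw [pd_FT r hcont hsupp, hfun, FT_const_mul, norm_mul, mul_pow, norm_inv, norm_pow,
      Complex.norm_real, Real.norm_eq_abs, abs_of_pos hs0, inv_pow, ← pow_mul, mul_comm 2]
  have hint : Integrable (fun ξ => ‖FT (fun x => (f x : ℂ) * Φ (s • x)) ξ‖ ^ 2) := by
    have := hfC.continuous
    have := hΦ.continuous
    exact (integral_norm_sq_FT_le (by fun_prop)
      (hasCompactSupport_mul_comp_smul _ hΦc hs0.ne')).1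
  simp only [hpd]
  rw [integral_const_mul]
  have hmono : ∫ ξ in Function.support (PsiJL g i j ℓ),
      ‖FT (fun x => (f x : ℂ) * Φ (s • x)) ξ‖ ^ 2 ≤
      ∫ ξ in E, ‖FT (fun x => (f x : ℂ) * Φ (s • x)) ξ‖ ^ 2 :=
    setIntegral_mono_set hint.integrableOn (.of_forall fun _ => by positivity)
      hsub.eventuallyLE
  have hrhs : (2 : ℝ) ^ (-(j : ℝ) * (2 * (u : ℝ) + 1 + (r.1 : ℝ) + (r.2 : ℝ))) =
      (s ^ (2 * (r.1 + r.2)))⁻¹ * (s ^ (2 + 2 * (2 * u)))⁻¹ := by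
    rw [← mul_inv, ← pow_add, hspow, ← Real.rpow_neg zero_le_two]
    congr 1
    push_cast
    ring
  have hCs := hC s hs1
  rw [min_self] at hCs
  rw [hrhs, mul_left_comm]
  gcongr
  rw [← div_eq_mul_inv, le_div_iff₀' (by positivity)]
  calc s ^ (2 + 2 * (2 * u)) * _ ≤ s ^ (2 + 2 * (2 * u)) * _ := by gcongr
    _ ≤ C := hCs
    _ ≤ C + 1 := by linarith
end
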